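/- Let V satisfy the standing assumptions and in addition y·W′(y) − W(y) ≥ C₀·y² for all y ≥ 0, for some C₀ > 0. There is a constant C > 0 depending only on d and C₀ such that the following holds. Let λ > 0 and let h : [0,T] × ℝ^d → ℝ be continuous, C¹ in time and C² in space on (0,T] × ℝ^d, bounded together with its spatial gradient on [0,T] × ℝ^d, solving ∂ₜh = Δh + λV(∇h) pointwise on (0,T] × ℝ^d with h(0,·) = h₀, and such that for every x ∈ ℝ^d, sup_{t∈[0,T]} (e^{2λ|h(t,·)|})*(x) < ∞. Then for every t ∈ (0,T] and x ∈ ℝ^d, |∇h(t,x)| ≤ C·( |||h₀|||_{H^λ}(x) / (λ·t) )^{1/2}, where |||h₀|||_{H^λ}(x) := (1/λ)·ln( (e^{λ|h₀|})*(x) ). -/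

import Mathlib

open MeasureTheory Real Set
open scoped ENNReal

noncomputable section

/-- The Laplacian of a function `f : ℝ^d → ℝ` at `x`, as the trace of the second derivative. -/
def lapl {d : ℕ} (f : EuclideanSpace ℝ (Fin d) → ℝ) (x : EuclideanSpace ℝ (Fin d)) : ℝ :=
  ∑ i : Fin d,
    iteratedFDeriv ℝ 2 f x ![EuclideanSpace.single i (1:ℝ), EuclideanSpace.single i (1:ℝ)]

/-- Standing assumptions on the deposition rate `V` (with radial profile `W`):
`V` is `C²`, isotropic, convex, `W 0 = 0`, `W ≥ 0` and `W y ≤ y²` on `[0,∞)`. -/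
structure IsDepositionRate (d : ℕ) (V : EuclideanSpace ℝ (Fin d) → ℝ) (W : ℝ → ℝ) : Prop where
  smooth : ContDiff ℝ 2 V
  isotropic : ∀ p, V p = W ‖p‖
  convex : ConvexOn ℝ Set.univ V
  zero : W 0 = 0
  nonneg : ∀ y : ℝ, 0 ≤ y → 0 ≤ W y
  quadGrowth : ∀ y : ℝ, 0 ≤ y → W y ≤ y ^ 2

/-- The pointwise maximal heat quantity
`f*(x) = sup_{τ>0} ∫ (2πτ)^{-d/2} e^{-|x-y|²/(2τ)} |f(y)| dy ∈ [0,∞]`. -/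
def fstar {d : ℕ} (f : EuclideanSpace ℝ (Fin d) → ℝ)
    (x : EuclideanSpace ℝ (Fin d)) : ℝ≥0∞ :=
  ⨆ τ ∈ Set.Ioi (0:ℝ),
    ∫⁻ y, ENNReal.ofReal ((2 * π * τ) ^ (-(d:ℝ)/2) * Real.exp (-‖x - y‖^2 / (2 * τ)) * |f y|)

/-- The pointwise quasi-norm of `H^λ`: `|||h₀|||_{H^λ}(x) = (1/λ) ln((e^{λ|h₀|})*(x))`. -/
def Hnorm {d : ℕ} (lam : ℝ) (h₀ : EuclideanSpace ℝ (Fin d) → ℝ)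
    (x : EuclideanSpace ℝ (Fin d)) : ℝ :=
  (1 / lam) * Real.log ((fstar (fun y => Real.exp (lam * |h₀ y|)) x).toReal)

abbrev EE (d : ℕ) := EuclideanSpace ℝ (Fin d)

def ee {d : ℕ} (i : Fin d) : EE d := EuclideanSpace.single i (1:ℝ)

def Jet {d : ℕ} (φ : EE d → ℝ) (x : EE d) (p : EE d) (L : ℝ) : Prop :=
  ∃ (D : Fin d → ℝ → ℝ) (l : Fin d → ℝ),
    (∀ i r, HasDerivAt (fun r : ℝ => φ (x + r • ee i)) (D i r) r) ∧
    (∀ i, HasDerivAt (D i) (l i) 0) ∧ (∀ i, D i 0 = p i) ∧ ∑ i, l i = L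

lemma hasDerivAt_line {d : ℕ} (x v : EE d) (r : ℝ) :
    HasDerivAt (fun r : ℝ => x + r • v) v r := by
  simpa using ((hasDerivAt_id r).smul_const v).const_add x

lemma gradient_apply {d : ℕ} (φ : EE d → ℝ) (x : EE d) (i : Fin d) :
    fderiv ℝ φ x (ee i) = gradient φ x i := by
  have : fderiv ℝ φ x (ee i) = inner ℝ (gradient φ x) (ee i) := by
    simp [gradient]
  rw [this, ee, EuclideanSpace.inner_single_right]; simp

lemma Jet.of_contDiff {d : ℕ} {φ : EE d → ℝ} (hφ : ContDiff ℝ 2 φ) (x : EE d) :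
    Jet φ x (gradient φ x) (lapl φ x) := by
  refine ⟨fun i r => fderiv ℝ φ (x + r • ee i) (ee i),
    fun i => fderiv ℝ (fderiv ℝ φ) x (ee i) (ee i), ?_, ?_, ?_, ?_⟩
  · intro i r
    exact ((hφ.differentiable (by norm_num)) _).hasFDerivAt.comp_hasDerivAt r
      (hasDerivAt_line x (ee i) r)
  · intro i
    have h1 : Differentiable ℝ (fderiv ℝ φ) :=
      (hφ.fderiv_right (m := 1) (by norm_num)).differentiable (by norm_num)
    have h2 : HasDerivAt (fun r : ℝ => fderiv ℝ φ (x + r • ee i))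
        (fderiv ℝ (fderiv ℝ φ) (x + (0:ℝ) • ee i) (ee i)) 0 :=
      (h1 _).hasFDerivAt.comp_hasDerivAt 0 (hasDerivAt_line x (ee i) 0)
    have h3 := h2.clm_apply (hasDerivAt_const (0:ℝ) (ee i))
    simpa using h3
  · intro i
    simp [gradient_apply]
  · simp [lapl, iteratedFDeriv_two_apply, ee]

lemma Jet.add {d : ℕ} {φ ψ : EE d → ℝ} {x p q : EE d} {L M : ℝ}
    (h1 : Jet φ x p L) (h2 : Jet ψ x q M) :
    Jet (fun y => φ y + ψ y) x (p + q) (L + M) := by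
  obtain ⟨D, l, a, b, c, e⟩ := h1
  obtain ⟨D', l', a', b', c', e'⟩ := h2
  refine ⟨fun i r => D i r + D' i r, fun i => l i + l' i, fun i r => (a i r).add (a' i r),
    fun i => (b i).add (b' i), fun i => by simp [c, c'], by simp [Finset.sum_add_distrib, e, e']⟩

lemma Jet.const_mul {d : ℕ} {φ : EE d → ℝ} {x p : EE d} {L : ℝ} (k : ℝ)
    (h1 : Jet φ x p L) : Jet (fun y => k * φ y) x (k • p) (k * L) := by
  obtain ⟨D, l, a, b, c, e⟩ := h1
  refine ⟨fun i r => k * D i r, fun i => k * l i, fun i r => (a i r).const_mul k,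
    fun i => (b i).const_mul k, fun i => by simp [c], by rw [← Finset.mul_sum, e]⟩

lemma Jet.const {d : ℕ} (k : ℝ) (x : EE d) : Jet (fun _ => k) x 0 0 := by
  refine ⟨fun i r => 0, fun i => 0, fun i r => hasDerivAt_const _ _,
    fun i => hasDerivAt_const _ _, fun i => by simp, by simp⟩

lemma Jet.translate {d : ℕ} {φ : EE d → ℝ} {x p ξ : EE d} {L : ℝ}
    (h1 : Jet φ (x + ξ) p L) : Jet (fun y => φ (y + ξ)) x p L := by
  obtain ⟨D, l, a, b, c, e⟩ := h1
  refine ⟨D, l, fun i r => ?_, b, c, e⟩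
  simpa [add_right_comm] using a i r

lemma Jet.exp {d : ℕ} {φ : EE d → ℝ} {x p : EE d} {L : ℝ}
    (h1 : Jet φ x p L) :
    Jet (fun y => Real.exp (φ y)) x (Real.exp (φ x) • p) (Real.exp (φ x) * (L + ‖p‖ ^ 2)) := by
  obtain ⟨D, l, a, b, c, e⟩ := h1
  refine ⟨fun i r => Real.exp (φ (x + r • ee i)) * D i r,
    fun i => Real.exp (φ x) * (l i + p i ^ 2), fun i r => (a i r).exp, ?_, ?_, ?_⟩
  · intro i
    have := ((a i 0).exp).mul (b i)
    refine HasDerivAt.congr_deriv this ?_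
    simp [c]; ring
  · intro i; simp [c]
  · rw [← Finset.mul_sum, Finset.sum_add_distrib, e, EuclideanSpace.real_norm_sq_eq]

lemma Jet.nonpos_of_max {d : ℕ} {φ : EE d → ℝ} {x p : EE d} {L : ℝ}
    (h1 : Jet φ x p L) (hm : ∀ y, φ y ≤ φ x) : L ≤ 0 := by
  obtain ⟨D, l, a, b, c, e⟩ := h1
  by_contra hL
  push Not at hL
  set f : ℝ → ℝ := fun r => ∑ i, φ (x + r • ee i) with hf
  have hd : ∀ r, HasDerivAt f (∑ i, D i r) r := fun r => HasDerivAt.fun_sum (fun i _ => a i r)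
  have hdf : deriv f = fun r => ∑ i, D i r := funext fun r => (hd r).deriv
  have hd2 : HasDerivAt (deriv f) L 0 := by
    rw [hdf, ← e]; exact HasDerivAt.fun_sum (fun i _ => b i)
  have hmax : IsLocalMax f 0 := by
    refine Filter.Eventually.of_forall fun r => ?_
    simp only [hf]
    refine Finset.sum_le_sum fun i _ => ?_
    simpa using hm _
  have hd0 : deriv f 0 = 0 := hmax.deriv_eq_zero
  have hmin : IsLocalMin f 0 := isLocalMin_of_deriv_deriv_pos (by rw [hd2.deriv]; exact hL) hd0
    (hd 0).continuousAt
  have hc : f =ᶠ[nhds 0] fun _ => f 0 := by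
    filter_upwards [hmax, hmin] with r h1 h2 using le_antisymm h1 h2
  have h3 : deriv f =ᶠ[nhds 0] fun _ => 0 := by
    have := hc.deriv
    simpa using this
  have := h3.deriv_eq
  rw [hd2.deriv] at this
  simp at this
  linarith

/-- the key algebraic inequality -/
lemma V_grad_ineq {d : ℕ} {V : EE d → ℝ} (hV : ContDiff ℝ 2 V)
    (hc : ConvexOn ℝ Set.univ V) (p r : EE d) :
    V p + fderiv ℝ V p (r - p) ≤ V r := by
  have hl : HasDerivAt (fun s : ℝ => V (p + s • (r - p))) (fderiv ℝ V p (r - p)) 0 := by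
    have := ((hV.differentiable (by norm_num)) (p + (0:ℝ) • (r - p))).hasFDerivAt.comp_hasDerivAt 0
      (hasDerivAt_line p (r - p) 0)
    rw [zero_smul, add_zero] at this
    exact this
  have hcc : ConvexOn ℝ Set.univ (fun s : ℝ => V (p + s • (r - p))) := by
    have := hc.comp_affineMap (AffineMap.lineMap p r : ℝ →ᵃ[ℝ] EE d)
    simp only [Set.preimage_univ] at this
    have e : (fun s : ℝ => V (p + s • (r - p))) = V ∘ (AffineMap.lineMap p r : ℝ →ᵃ[ℝ] EE d) := by
      funext s
      simp [AffineMap.lineMap_apply, add_comm]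
    rw [e]; exact this
  have := hcc.le_slope_of_hasDerivAt (Set.mem_univ 0) (Set.mem_univ 1) one_pos hl
  simp [slope_def_field] at this
  simp
  linarith

lemma V_radial {d : ℕ} {V : EE d → ℝ} {W : ℝ → ℝ} (hV : IsDepositionRate d V W) (p : EE d) :
    fderiv ℝ V p p = ‖p‖ * deriv W ‖p‖ := by
  by_cases hp : p = 0
  · simp [hp]
  have hn : 0 < ‖p‖ := norm_pos_iff.2 hp
  have h1 : HasDerivAt (fun s : ℝ => V (s • (‖p‖⁻¹ • p))) (fderiv ℝ V p (‖p‖⁻¹ • p)) ‖p‖ := by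
    have h0 := (hasDerivAt_id ‖p‖).smul_const (‖p‖⁻¹ • p)
    have := ((hV.smooth.differentiable (by norm_num)) (‖p‖ • (‖p‖⁻¹ • p))).hasFDerivAt.comp_hasDerivAt ‖p‖ h0
    rw [smul_inv_smul₀ hn.ne', one_smul] at this
    exact this
  have h2 : W =ᶠ[nhds ‖p‖] (fun s : ℝ => V (s • (‖p‖⁻¹ • p))) := by
    filter_upwards [lt_mem_nhds hn] with s hs
    rw [hV.isotropic, norm_smul, norm_smul, norm_inv, norm_norm, inv_mul_cancel₀ hn.ne']
    simp [abs_of_pos hs]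
  rw [h2.deriv_eq, h1.deriv]
  simp only [map_smul, smul_eq_mul]
  field_simp

lemma V_key {d : ℕ} {V : EE d → ℝ} {W : ℝ → ℝ} {C₀ : ℝ} (hV : IsDepositionRate d V W)
    (hW : ∀ y : ℝ, 0 ≤ y → C₀ * y ^ 2 ≤ y * deriv W y - W y) (a : ℝ) (ha : 1 ≤ a) (p p' : EE d) :
    (1 - a) * V p + a * V p' + C₀ / 2 * ‖p'‖ ^ 2 ≤ 2 * ‖(1 - a) • p + a • p'‖ ^ 2 := by
  set q := (1 - a) • p + a • p' with hq
  have h1 := V_grad_ineq hV.smooth hV.convex p' p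
  have h2 := V_grad_ineq hV.smooth hV.convex p' ((2:ℝ) • q)
  have h3 : V ((2:ℝ) • q) ≤ 4 * ‖q‖ ^ 2 := by
    rw [hV.isotropic]
    refine (hV.quadGrowth _ (norm_nonneg _)).trans ?_
    rw [norm_smul]; norm_num; nlinarith
  have h4 := hW ‖p'‖ (norm_nonneg _)
  rw [← V_radial hV, ← hV.isotropic] at h4
  have h5 : fderiv ℝ V p' q = (1 - a) * fderiv ℝ V p' p + a * fderiv ℝ V p' p' := by
    simp [hq]
  simp only [map_sub, map_smul, smul_eq_mul] at h1 h2
  nlinarith [mul_le_mul_of_nonneg_left h1 (sub_nonneg.2 ha)]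

lemma absmax {X : Type*} [TopologicalSpace X] {t0 t1 : ℝ} {m : ℝ → X → ℝ}
    (hc : ContinuousOn (fun q : ℝ × X => m q.1 q.2) (Set.Icc t0 t1 ×ˢ Set.univ))
    {K : Set X} (hK : IsCompact K) (hKm : ∀ t ∈ Set.Icc t0 t1, ∀ x, x ∉ K → m t x ≤ 0)
    (h0 : ∀ x, m t0 x ≤ 0)
    (hmax : ∀ t ∈ Set.Ioc t0 t1, ∀ x, (∀ s ∈ Set.Icc t0 t1, ∀ y, m s y ≤ m t x) → False) :
    ∀ t ∈ Set.Icc t0 t1, ∀ x, m t x ≤ 0 := by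
  intro t ht x
  by_contra hpos
  push Not at hpos
  have hxK : x ∈ K := by
    by_contra hx
    exact absurd (hKm t ht x hx) (not_le.2 hpos)
  obtain ⟨⟨s, y⟩, ⟨hs, hy⟩, hM⟩ := (isCompact_Icc.prod hK).exists_isMaxOn (s := Set.Icc t0 t1 ×ˢ K)
    ⟨(t, x), ht, hxK⟩ (hc.mono (Set.prod_mono le_rfl (Set.subset_univ _)))
  simp only at hs hy
  have h1 : m t x ≤ m s y := hM (Set.mk_mem_prod ht hxK)
  have hs0 : t0 < s := by
    rcases hs.1.lt_or_eq with h | h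
    · exact h
    · subst h
      have := h0 y
      linarith
  refine hmax s ⟨hs0, hs.2⟩ y fun s' hs' y' => ?_
  by_cases hy' : y' ∈ K
  · exact hM (Set.mk_mem_prod hs' hy')
  · have := hKm s' hs' y' hy'
    linarith

lemma deriv_nonneg_of_max {g : ℝ → ℝ} {g' t0 t : ℝ} (ht : t0 < t) (hg : HasDerivAt g g' t)
    (hm : ∀ s ∈ Set.Icc t0 t, g s ≤ g t) : 0 ≤ g' := by
  have h1 : Filter.Tendsto (slope g t) (nhdsWithin t (Set.Iio t)) (nhds g') := by
    have := hg.hasDerivWithinAt (s := Set.Iio t)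
    rwa [hasDerivWithinAt_iff_tendsto_slope' (by simp)] at this
  refine ge_of_tendsto h1 ?_
  have : Set.Ioo t0 t ∈ nhdsWithin t (Set.Iio t) := Ioo_mem_nhdsLT ht
  filter_upwards [this] with s hs
  rw [slope_def_field]
  exact div_nonneg_of_nonpos (by linarith [hm s ⟨hs.1.le, hs.2.le⟩]) (by linarith [hs.2])

lemma norm_line_sq {d : ℕ} (v : EE d) (i : Fin d) (r : ℝ) :
    ‖v + r • ee i‖ ^ 2 = ‖v‖ ^ 2 + 2 * r * v i + r ^ 2 := by
  rw [norm_add_sq_real, inner_smul_right, norm_smul, ee, EuclideanSpace.inner_single_right]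
  simp; ring

lemma Jet.normsq {d : ℕ} (x x0 : EE d) :
    Jet (fun y => ‖y - x0‖ ^ 2) x ((2:ℝ) • (x - x0)) (2 * d) := by
  refine ⟨fun i r => 2 * (x - x0) i + 2 * r, fun i => 2, fun i r => ?_, fun i => ?_, fun i => ?_, ?_⟩
  · have : (fun r : ℝ => ‖x + r • ee i - x0‖ ^ 2) =
        fun r => ‖x - x0‖ ^ 2 + 2 * r * (x - x0) i + r ^ 2 := by
      funext r
      rw [← norm_line_sq]; congr 2; abel
    rw [this]
    have h1 : HasDerivAt (fun r : ℝ => 2 * r * (x - x0) i) (2 * 1 * (x - x0) i) r :=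
      ((hasDerivAt_id r).const_mul 2).mul_const _
    have h2 := (h1.const_add (‖x - x0‖ ^ 2)).add (hasDerivAt_pow 2 r)
    refine h2.congr_deriv ?_
    simp
  · simpa using ((hasDerivAt_id (0:ℝ)).const_mul 2).const_add (2 * (x - x0) i)
  · simp
  · simp; ring

def Eg {d : ℕ} (b τ : ℝ) (v : EE d) : ℝ :=
  Real.exp ((b + 16 * b ^ 2 * τ) * ‖v‖ ^ 2 + 5 * d * b * τ)

lemma Eg_pos {d : ℕ} (b τ : ℝ) (v : EE d) : 0 < Eg b τ v := Real.exp_pos _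

lemma Eg_continuous {d : ℕ} (b : ℝ) : Continuous (fun q : ℝ × EE d => Eg b q.1 q.2) := by
  unfold Eg; fun_prop

lemma Eg_jet {d : ℕ} (hd : 1 ≤ d) {b τ : ℝ} (hb : 0 < b) (hτ : 0 ≤ τ) (hbτ : 16 * b * τ ≤ 1)
    (x x0 : EE d) : ∃ e' p L, HasDerivAt (fun τ => Eg b τ (x - x0)) e' τ ∧
      Jet (fun y => Eg b τ (y - x0)) x p L ∧ L < e' := by
  have hj := ((Jet.normsq x x0).const_mul (b + 16 * b ^ 2 * τ)).add (Jet.const (5 * d * b * τ) x)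
  have ht : HasDerivAt (fun τ => (b + 16 * b ^ 2 * τ) * ‖x - x0‖ ^ 2 + 5 * d * b * τ)
      ((16 * b ^ 2) * ‖x - x0‖ ^ 2 + 5 * d * b) τ := by
    have h1 := ((((hasDerivAt_id τ).const_mul (16 * b ^ 2)).const_add b).mul_const (‖x - x0‖ ^ 2)).add
      ((hasDerivAt_id τ).const_mul (5 * d * b))
    refine h1.congr_deriv ?_
    simp
  refine ⟨_, _, _, ht.exp, hj.exp, ?_⟩
  simp only [add_zero]
  refine mul_lt_mul_of_pos_left ?_ (Real.exp_pos _)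
  have hd' : (1:ℝ) ≤ d := by exact_mod_cast hd
  set β := b + 16 * b ^ 2 * τ with hβ
  have hβ2 : β ≤ 2 * b := by nlinarith
  have hβ0 : 0 ≤ β := by positivity
  rw [norm_smul, norm_smul, mul_pow, mul_pow]
  simp only [Real.norm_eq_abs, sq_abs]
  have h1 : β ^ 2 ≤ 4 * b ^ 2 := by nlinarith
  have h2 : β * (2 * d) ≤ 4 * d * b := by nlinarith
  have h3 : 0 < d * b := by positivity
  have h4 := mul_le_mul_of_nonneg_right h1 (sq_nonneg ‖x - x0‖)
  nlinarith

lemma gauss_integrable {d : ℕ} {a : ℝ} (ha : 0 < a) :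
    Integrable (fun v : EE d => Real.exp (-a * ‖v‖ ^ 2)) := by
  by_contra h
  have h1 := GaussianFourier.integral_rexp_neg_mul_sq_norm (V := EE d) ha
  rw [integral_undef h] at h1
  have : 0 < (π / a) ^ ((Module.finrank ℝ (EE d) : ℝ) / 2) := by positivity
  linarith

lemma gauss_integrable' {d : ℕ} {a : ℝ} (ha : 0 < a) (y : EE d) :
    Integrable (fun z : EE d => Real.exp (-a * ‖y - z‖ ^ 2)) :=
  (gauss_integrable ha).comp_sub_left y

lemma space_deriv {d : ℕ} {g g' f : EE d → ℝ} {i : Fin d} {C a B : ℝ} (hC : 0 ≤ C)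
    (hg : Continuous g) (hg' : Continuous g') (hf : Continuous f) (ha : 0 < a)
    (hB : ∀ z, |f z| ≤ B)
    (hgg : ∀ v r, HasDerivAt (fun r : ℝ => g (v + r • ee i)) (g' (v + r • ee i)) r)
    (hgb : ∀ u, |g u| ≤ C * Real.exp (-a * ‖u‖ ^ 2))
    (hgb' : ∀ u, |g' u| ≤ C * Real.exp (-a * ‖u‖ ^ 2)) (y : EE d) (r0 : ℝ) :
    Integrable (fun z => g' (y + r0 • ee i - z) * f z) ∧
    HasDerivAt (fun r : ℝ => ∫ z, g (y + r • ee i - z) * f z)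
      (∫ z, g' (y + r0 • ee i - z) * f z) r0 := by
  have hB0 : 0 ≤ B := (abs_nonneg _).trans (hB 0)
  have key : ∀ (k : EE d → ℝ), (∀ u, |k u| ≤ C * Real.exp (-a * ‖u‖ ^ 2)) →
      ∀ z, ∀ r ∈ Metric.ball r0 1, ‖k (y + r • ee i - z) * f z‖ ≤
        C * B * Real.exp a * Real.exp (-(a / 2) * ‖y + r0 • ee i - z‖ ^ 2) := by
    intro k hk z r hr
    rw [norm_mul]
    simp only [Real.norm_eq_abs]
    have h1 := mul_le_mul (hk (y + r • ee i - z)) (hB z) (abs_nonneg _) (by positivity)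
    refine h1.trans ?_
    have h2 : ‖y + r0 • ee i - z‖ ^ 2 ≤ 2 * ‖y + r • ee i - z‖ ^ 2 + 2 := by
      have e1 : y + r0 • ee i - z = (y + r • ee i - z) + (r0 - r) • ee i := by
        rw [sub_smul]; abel
      have e2 : ‖(r0 - r) • (ee i : EE d)‖ ≤ 1 := by
        rw [norm_smul, ee, EuclideanSpace.norm_single]
        rw [Metric.mem_ball, Real.dist_eq, abs_sub_comm] at hr
        simp; exact hr.le
      have e3 : ‖y + r0 • ee i - z‖ ≤ ‖y + r • ee i - z‖ + 1 := by
        rw [e1]; exact (norm_add_le _ _).trans (by linarith)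
      have e4 := norm_nonneg (y + r0 • ee i - z)
      nlinarith [sq_nonneg (‖y + r • ee i - z‖ - 1)]
    have h3 : Real.exp (-a * ‖y + r • ee i - z‖ ^ 2) ≤
        Real.exp a * Real.exp (-(a / 2) * ‖y + r0 • ee i - z‖ ^ 2) := by
      rw [← Real.exp_add]
      apply Real.exp_le_exp.2
      nlinarith
    calc _ = C * B * Real.exp (-a * ‖y + r • ee i - z‖ ^ 2) := by ring
      _ ≤ C * B * (Real.exp a * Real.exp (-(a / 2) * ‖y + r0 • ee i - z‖ ^ 2)) := by gcongr
      _ = _ := by ring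
  have hbi : Integrable (fun z => C * B * Real.exp a *
      Real.exp (-(a / 2) * ‖y + r0 • ee i - z‖ ^ 2)) :=
    (gauss_integrable' (by positivity) _).const_mul _
  refine hasDerivAt_integral_of_dominated_loc_of_deriv_le (F := fun r z => g (y + r • ee i - z) * f z)
    (F' := fun r z => g' (y + r • ee i - z) * f z)
    (Metric.ball_mem_nhds r0 one_pos) ?_ ?_ ?_ ?_ hbi ?_
  · refine Filter.Eventually.of_forall fun r => Continuous.aestronglyMeasurable ?_
    fun_prop
  · refine hbi.mono' (Continuous.aestronglyMeasurable (by fun_prop)) ?_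
    exact Filter.Eventually.of_forall fun z => key g hgb z r0 (by simp)
  · exact Continuous.aestronglyMeasurable (by fun_prop)
  · exact Filter.Eventually.of_forall fun z r hr => key g' hgb' z r hr
  · refine Filter.Eventually.of_forall fun z r hr => ?_
    have := (hgg (y - z) r).mul_const (f z)
    simpa [sub_add_eq_add_sub] using this

def ker (d : ℕ) (s : ℝ) (v : EE d) : ℝ :=
  Real.exp (-((d:ℝ) / 2) * Real.log s - ‖v‖ ^ 2 / (4 * s))

lemma ker_pos {d : ℕ} (s : ℝ) (v : EE d) : 0 < ker d s v := Real.exp_pos _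

lemma ker_continuous {d : ℕ} (s : ℝ) : Continuous (ker d s) := by
  unfold ker; fun_prop

lemma ker_time {d : ℕ} {f : EE d → ℝ} {B s0 : ℝ} (hs0 : 0 < s0) (hf : Continuous f)
    (hB : ∀ z, |f z| ≤ B) (y : EE d) :
    HasDerivAt (fun s : ℝ => ∫ z, ker d s (y - z) * f z)
      (∫ z, ker d s0 (y - z) * (‖y - z‖ ^ 2 / (4 * s0 ^ 2) - d / (2 * s0)) * f z) s0 := by
  have hB0 : 0 ≤ B := (abs_nonneg _).trans (hB 0)
  set A := Real.exp (-((d:ℝ) / 2) * Real.log (s0 / 2)) with hA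
  have hA0 : 0 < A := Real.exp_pos _
  have hker : ∀ s ∈ Set.Ioo (s0 / 2) (2 * s0), ∀ v : EE d,
      ker d s v ≤ A * Real.exp (-(1 / (8 * s0)) * ‖v‖ ^ 2) := by
    intro s hs v
    have hsp : 0 < s := by linarith [hs.1]
    rw [hA, ← Real.exp_add, ker]
    apply Real.exp_le_exp.2
    have h1 : Real.log (s0 / 2) ≤ Real.log s := Real.log_le_log (by positivity) hs.1.le
    have h2 : (1 / (8 * s0)) * ‖v‖ ^ 2 ≤ ‖v‖ ^ 2 / (4 * s) := by
      rw [div_mul_eq_mul_div, one_mul]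
      apply div_le_div_of_nonneg_left (by positivity) (by positivity)
      linarith [hs.2]
    have h3 : (d:ℝ) / 2 * Real.log (s0 / 2) ≤ d / 2 * Real.log s := by gcongr
    linarith
  have hbi : ∀ k : ℝ, Integrable (fun z => k * Real.exp (-(1 / (16 * s0)) * ‖y - z‖ ^ 2)) :=
    fun k => (gauss_integrable' (by positivity) _).const_mul _
  have hmem : s0 ∈ Set.Ioo (s0 / 2) (2 * s0) := ⟨by linarith, by linarith⟩
  have hkc := ker_continuous (d := d) s0
  refine (hasDerivAt_integral_of_dominated_loc_of_deriv_le (F := fun s z => ker d s (y - z) * f z)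
    (F' := fun s z => ker d s (y - z) * (‖y - z‖ ^ 2 / (4 * s ^ 2) - d / (2 * s)) * f z)
    (Ioo_mem_nhds hmem.1 hmem.2) ?_ ?_ ?_ ?_ (hbi (A * (16 / s0 + d / s0) * B)) ?_).2
  · refine Filter.Eventually.of_forall fun s => Continuous.aestronglyMeasurable ?_
    have := ker_continuous (d := d) s
    fun_prop
  · refine (hbi (A * B)).mono' (Continuous.aestronglyMeasurable (by fun_prop)) ?_
    refine Filter.Eventually.of_forall fun z => ?_
    rw [norm_mul, Real.norm_eq_abs, Real.norm_eq_abs, abs_of_pos (ker_pos _ _)]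
    have h1 := mul_le_mul (hker s0 hmem (y - z)) (hB z) (abs_nonneg _) (by positivity)
    refine h1.trans ?_
    have : Real.exp (-(1 / (8 * s0)) * ‖y - z‖ ^ 2) ≤ Real.exp (-(1 / (16 * s0)) * ‖y - z‖ ^ 2) := by
      apply Real.exp_le_exp.2
      have : 1 / (16 * s0) ≤ 1 / (8 * s0) :=
        one_div_le_one_div_of_le (by positivity) (by linarith)
      nlinarith [sq_nonneg ‖y - z‖]
    calc _ = A * B * Real.exp (-(1 / (8 * s0)) * ‖y - z‖ ^ 2) := by ring
      _ ≤ _ := by gcongr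
  · exact Continuous.aestronglyMeasurable (by fun_prop)
  · refine Filter.Eventually.of_forall fun z s hs => ?_
    have hsp : 0 < s := by linarith [hs.1]
    rw [norm_mul, norm_mul, Real.norm_eq_abs, Real.norm_eq_abs, Real.norm_eq_abs,
      abs_of_pos (ker_pos _ _)]
    set X := ‖y - z‖ ^ 2 with hX
    have hX0 : 0 ≤ X := by positivity
    have h2 : |X / (4 * s ^ 2) - d / (2 * s)| ≤
        (16 / s0 + d / s0) * Real.exp (1 / (16 * s0) * X) := by
      have e1 : X / (4 * s ^ 2) ≤ X / s0 ^ 2 := by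
        apply div_le_div_of_nonneg_left hX0 (by positivity)
        nlinarith [hs.1]
      have e2 : (d:ℝ) / (2 * s) ≤ d / s0 := by
        apply div_le_div_of_nonneg_left (by positivity) hs0
        linarith [hs.1]
      have e3 : 1 / (16 * s0) * X + 1 ≤ Real.exp (1 / (16 * s0) * X) := Real.add_one_le_exp _
      have e3' : 0 ≤ 1 / (16 * s0) * X := by positivity
      have e4 : X / s0 ^ 2 = 16 / s0 * (1 / (16 * s0) * X) := by field_simp
      have e5 : 16 / s0 * (1 / (16 * s0) * X) ≤ 16 / s0 * Real.exp (1 / (16 * s0) * X) := by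
        gcongr; linarith
      have e6 : (d:ℝ) / s0 * 1 ≤ d / s0 * Real.exp (1 / (16 * s0) * X) := by
        gcongr; linarith
      have e7 : 0 ≤ X / (4 * s ^ 2) := by positivity
      have e8 : 0 ≤ (d:ℝ) / (2 * s) := by positivity
      rw [abs_le]; constructor <;> nlinarith
    have h1 := mul_le_mul (mul_le_mul (hker s hs (y - z)) h2 (abs_nonneg _) (by positivity))
      (hB z) (abs_nonneg _) (by positivity)
    refine h1.trans (le_of_eq ?_)
    have : Real.exp (-(1 / (8 * s0)) * X) * Real.exp (1 / (16 * s0) * X) =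
        Real.exp (-(1 / (16 * s0)) * X) := by
      rw [← Real.exp_add]; congr 1; field_simp; ring
    rw [← this]; ring
  · refine Filter.Eventually.of_forall fun z s hs => ?_
    have hsp : 0 < s := by linarith [hs.1]
    refine HasDerivAt.mul_const ?_ _
    have h1 : HasDerivAt (fun s : ℝ => -((d:ℝ) / 2) * Real.log s - ‖y - z‖ ^ 2 / (4 * s))
        (‖y - z‖ ^ 2 / (4 * s ^ 2) - d / (2 * s)) s := by
      have e1 := (Real.hasDerivAt_log hsp.ne').const_mul (-((d:ℝ) / 2))
      have e2 := (hasDerivAt_const s (‖y - z‖ ^ 2)).fun_div ((hasDerivAt_id s).const_mul 4) (by simp; exact hsp.ne')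
      refine (e1.sub e2).congr_deriv ?_
      simp
      field_simp; ring
    exact h1.exp

lemma ker_jet {d : ℕ} {f : EE d → ℝ} {B s : ℝ} (hs : 0 < s) (hf : Continuous f)
    (hB : ∀ z, |f z| ≤ B) (y : EE d) :
    ∃ p, Jet (fun y => ∫ z, ker d s (y - z) * f z) y p
      (∫ z, ker d s (y - z) * (‖y - z‖ ^ 2 / (4 * s ^ 2) - d / (2 * s)) * f z) := by
  have hB0 : 0 ≤ B := (abs_nonneg _).trans (hB 0)
  set A := Real.exp (-((d:ℝ) / 2) * Real.log s) with hA
  have hA0 : 0 < A := Real.exp_pos _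
  set a := 1 / (8 * s) with haa
  have ha : 0 < a := by positivity
  have hker : ∀ u : EE d, ker d s u = A * Real.exp (-a * ‖u‖ ^ 2) * Real.exp (-a * ‖u‖ ^ 2) := by
    intro u
    rw [hA, ← Real.exp_add, ← Real.exp_add, ker]
    congr 1; rw [haa]; field_simp; ring
  set C := A * (1 + 1 / s ^ 2 + 8 * s + 2 / s) with hCC
  have hC : 0 ≤ C := by positivity
  -- a weight of size `q ≤ k (1 + a ‖u‖^2)` is absorbed
  have habs : ∀ (u : EE d) (q : ℝ), |q| ≤ (1 + 1 / s ^ 2 + 8 * s + 2 / s) * (a * ‖u‖ ^ 2 + 1) →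
      |ker d s u * q| ≤ C * Real.exp (-a * ‖u‖ ^ 2) := by
    intro u q hq
    rw [abs_mul, abs_of_pos (ker_pos _ _), hker]
    have e3 : a * ‖u‖ ^ 2 + 1 ≤ Real.exp (a * ‖u‖ ^ 2) := Real.add_one_le_exp _
    have e4 : |q| ≤ (1 + 1 / s ^ 2 + 8 * s + 2 / s) * Real.exp (a * ‖u‖ ^ 2) :=
      hq.trans (by gcongr)
    calc _ ≤ A * Real.exp (-a * ‖u‖ ^ 2) * Real.exp (-a * ‖u‖ ^ 2) *
          ((1 + 1 / s ^ 2 + 8 * s + 2 / s) * Real.exp (a * ‖u‖ ^ 2)) := by gcongr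
      _ = C * Real.exp (-a * ‖u‖ ^ 2) * (Real.exp (-a * ‖u‖ ^ 2) * Real.exp (a * ‖u‖ ^ 2)) := by
        rw [hCC]; ring
      _ = _ := by rw [← Real.exp_add]; simp
  have hui : ∀ (u : EE d) (i : Fin d), u i ^ 2 ≤ ‖u‖ ^ 2 := by
    intro u i
    have := EuclideanSpace.norm_sq_eq u
    rw [this]
    have := Finset.single_le_sum (f := fun j => ‖u j‖ ^ 2) (fun j _ => sq_nonneg _) (Finset.mem_univ i)
    simpa using this
  have has : a * s = 1 / 8 := by rw [haa]; field_simp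
  have hkc := ker_continuous (d := d) s
  have hpc : ∀ i : Fin d, Continuous fun u : EE d => u i := fun i => by fun_prop
  -- bounds
  have b0 : ∀ u : EE d, |ker d s u| ≤ C * Real.exp (-a * ‖u‖ ^ 2) := by
    intro u
    have := habs u 1 (by
      rw [abs_one]
      have : 0 ≤ a * ‖u‖ ^ 2 := by positivity
      have h2 : 0 ≤ 1 / s ^ 2 + 8 * s + 2 / s := by positivity
      nlinarith)
    simpa using this
  have b1 : ∀ (i : Fin d) (u : EE d), |ker d s u * (-(u i) / (2 * s))| ≤ C * Real.exp (-a * ‖u‖ ^ 2) := by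
    intro i u
    apply habs
    have h1 : |-(u i) / (2 * s)| ≤ 1 / s ^ 2 + ‖u‖ ^ 2 := by
      rw [abs_div, abs_neg, abs_of_pos (by positivity : 0 < 2 * s)]
      have e : |u i| / (2 * s) = |u i| * (1 / s) / 2 := by field_simp
      rw [e]
      have := hui u i
      have h2 : (1 / s) ^ 2 = 1 / s ^ 2 := by field_simp
      rw [← h2]
      nlinarith [sq_nonneg (|u i| - 1 / s), sq_abs (u i), sq_nonneg (1 / s), sq_nonneg (u i)]
    have h2 : 0 ≤ a * ‖u‖ ^ 2 := by positivity
    have h4 : ‖u‖ ^ 2 = 8 * s * (a * ‖u‖ ^ 2) := by rw [haa]; field_simp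
    set X := a * ‖u‖ ^ 2 with hX
    have h5 : 0 ≤ 1 / s ^ 2 := by positivity
    have h6 : 0 ≤ 2 / s := by positivity
    rw [h4] at h1
    refine h1.trans ?_
    nlinarith [mul_nonneg h5 h2, mul_nonneg h6 h2]
  have b2 : ∀ (i : Fin d) (u : EE d), |ker d s u * (u i ^ 2 / (4 * s ^ 2) - 1 / (2 * s))| ≤
      C * Real.exp (-a * ‖u‖ ^ 2) := by
    intro i u
    apply habs
    have h2 : 0 ≤ a * ‖u‖ ^ 2 := by positivity
    have h4 : ‖u‖ ^ 2 / (4 * s ^ 2) = 2 / s * (a * ‖u‖ ^ 2) := by rw [haa]; field_simp; ring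
    have h7 : u i ^ 2 / (4 * s ^ 2) ≤ ‖u‖ ^ 2 / (4 * s ^ 2) := by gcongr ?_ / _; exact hui u i
    have h8 : 0 ≤ u i ^ 2 / (4 * s ^ 2) := by positivity
    have h9 : 1 / (2 * s) ≤ 2 / s := by
      rw [div_le_div_iff₀ (by positivity) hs]; nlinarith
    have h10 : 0 ≤ 1 / (2 * s) := by positivity
    rw [h4] at h7
    set X := a * ‖u‖ ^ 2 with hX
    have h5 : 0 ≤ 1 / s ^ 2 := by positivity
    have h6 : 0 ≤ 2 / s := by positivity
    have h11 : 2 / s * X + 2 / s ≤ (1 + 1 / s ^ 2 + 8 * s + 2 / s) * (X + 1) := by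
      nlinarith [mul_nonneg h5 h2, mul_nonneg hs.le h2]
    rw [abs_le]; constructor <;> linarith [mul_nonneg h6 h2]
  -- derivatives
  have d0 : ∀ (i : Fin d) (v : EE d) (r : ℝ), HasDerivAt (fun r : ℝ => ker d s (v + r • ee i))
      (ker d s (v + r • ee i) * (-((v + r • ee i) i) / (2 * s))) r := by
    intro i v r
    have h1 : HasDerivAt (fun r : ℝ => -((d:ℝ) / 2) * Real.log s - ‖v + r • ee i‖ ^ 2 / (4 * s))
        (-((v + r • ee i) i) / (2 * s)) r := by
      simp_rw [norm_line_sq]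
      have e1 : HasDerivAt (fun r : ℝ => 2 * r * v i) (2 * 1 * v i) r :=
        ((hasDerivAt_id r).const_mul 2).mul_const _
      have e2 := (((e1.const_add (‖v‖ ^ 2)).add (hasDerivAt_pow 2 r)).div_const (4 * s)).const_sub
        (-((d:ℝ) / 2) * Real.log s)
      refine e2.congr_deriv ?_
      simp [ee]; field_simp; ring
    exact h1.exp
  have d1 : ∀ (i : Fin d) (v : EE d) (r : ℝ),
      HasDerivAt (fun r : ℝ => ker d s (v + r • ee i) * (-((v + r • ee i) i) / (2 * s)))
      (ker d s (v + r • ee i) * ((v + r • ee i) i ^ 2 / (4 * s ^ 2) - 1 / (2 * s))) r := by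
    intro i v r
    have e0 : HasDerivAt (fun r : ℝ => -((v + r • ee i) i) / (2 * s)) (-1 / (2 * s)) r := by
      have : (fun r : ℝ => -((v + r • ee i) i) / (2 * s)) = fun r => -(v i + r) / (2 * s) := by
        funext r; simp [ee]
      rw [this]
      exact (((hasDerivAt_id r).const_add (v i)).neg).div_const _
    refine ((d0 i v r).mul e0).congr_deriv ?_
    field_simp; ring
  have s0 := fun i => space_deriv (i := i) hC hkc (by fun_prop) hf ha hB (d0 i) b0 (b1 i)
  have s1 := fun i => space_deriv (i := i) hC (by fun_prop) (by fun_prop) hf ha hB (d1 i) (b1 i) (b2 i)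
  refine ⟨WithLp.toLp 2 fun i => ∫ z, ker d s (y + (0:ℝ) • ee i - z) * (-((y + (0:ℝ) • ee i - z) i) / (2 * s)) * f z,
    fun i r => ∫ z, ker d s (y + r • ee i - z) * (-((y + r • ee i - z) i) / (2 * s)) * f z,
    fun i => ∫ z, ker d s (y + (0:ℝ) • ee i - z) * ((y + (0:ℝ) • ee i - z) i ^ 2 / (4 * s ^ 2) - 1 / (2 * s)) * f z,
    fun i r => (s0 i y r).2, fun i => (s1 i y 0).2, fun i => rfl, ?_⟩
  rw [← integral_finsetSum _ (fun i _ => (s1 i y 0).1)]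
  congr 1; funext z
  simp only [zero_smul, add_zero]
  rw [← Finset.sum_mul, ← Finset.mul_sum, Finset.sum_sub_distrib, ← Finset.sum_div,
    ← EuclideanSpace.real_norm_sq_eq]
  simp; left; left; field_simp

def hk {d : ℕ} (f : EE d → ℝ) (t : ℝ) (y : EE d) : ℝ :=
  (4 * π) ^ (-(d:ℝ) / 2) * ∫ z : EE d, Real.exp (-(1 / 4) * ‖z‖ ^ 2) * f (y - √t • z)

lemma hk_continuous {d : ℕ} {f : EE d → ℝ} {B : ℝ} (hf : Continuous f)
    (hB : ∀ z, |f z| ≤ B) : Continuous (fun q : ℝ × EE d => hk f q.1 q.2) := by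
  unfold hk
  refine Continuous.mul continuous_const ?_
  refine continuous_of_dominated (bound := fun z => Real.exp (-(1 / 4) * ‖z‖ ^ 2) * B) ?_ ?_ ?_ ?_
  · intro q
    exact Continuous.aestronglyMeasurable (by fun_prop)
  · intro q
    refine Filter.Eventually.of_forall fun z => ?_
    rw [norm_mul, Real.norm_eq_abs, Real.norm_eq_abs, abs_of_pos (Real.exp_pos _)]
    gcongr
    exact hB _
  · exact (gauss_integrable (by norm_num)).mul_const _
  · refine Filter.Eventually.of_forall fun z => ?_
    fun_prop

lemma hk_zero {d : ℕ} (f : EE d → ℝ) (y : EE d) : hk f 0 y = f y := by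
  unfold hk
  simp only [Real.sqrt_zero, zero_smul, sub_zero]
  rw [integral_mul_const, GaussianFourier.integral_rexp_neg_mul_sq_norm (by norm_num)]
  rw [finrank_euclideanSpace_fin, ← mul_assoc, show π / (1 / 4) = 4 * π by ring,
    ← Real.rpow_add (by positivity)]
  rw [show -(d:ℝ) / 2 + d / 2 = 0 by ring]
  simp

lemma hk_eq {d : ℕ} (f : EE d → ℝ) {t : ℝ} (ht : 0 < t) (y : EE d) :
    hk f t y = (4 * π) ^ (-(d:ℝ) / 2) * ∫ z, ker d t (y - z) * f z := by
  unfold hk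
  congr 1
  have h1 : ∫ z, ker d t (y - z) * f z = ∫ v, ker d t v * f (y - v) := by
    rw [← integral_sub_left_eq_self (fun z => ker d t (y - z) * f z) volume y]
    simp
  rw [h1]
  have h2 := Measure.integral_comp_smul (volume : Measure (EE d)) (fun v => ker d t v * f (y - v)) (√t)
  have hst : 0 < √t := Real.sqrt_pos.2 ht
  rw [finrank_euclideanSpace_fin, abs_of_pos (by positivity), smul_eq_mul] at h2
  have h3 : ∫ v, ker d t v * f (y - v) = √t ^ d * ∫ x, ker d t (√t • x) * f (y - √t • x) := by
    rw [h2]; field_simp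
  rw [h3, ← integral_const_mul]
  congr 1; funext z
  rw [← mul_assoc]
  congr 1
  have h4 : √t ^ d = Real.exp ((d:ℝ) / 2 * Real.log t) := by
    rw [Real.sqrt_eq_rpow, ← Real.rpow_natCast, ← Real.rpow_mul ht.le, Real.rpow_def_of_pos ht]
    congr 1; ring
  rw [h4, ker, ← Real.exp_add, norm_smul, mul_pow, Real.norm_eq_abs, sq_abs, Real.sq_sqrt ht.le]
  congr 1
  field_simp; ring

lemma hk_sol {d : ℕ} {f : EE d → ℝ} {B t : ℝ} (ht : 0 < t) (hf : Continuous f)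
    (hB : ∀ z, |f z| ≤ B) (y : EE d) :
    ∃ p L, HasDerivAt (fun s => hk f s y) L t ∧ Jet (hk f t) y p L := by
  obtain ⟨p, hp⟩ := ker_jet ht hf hB y
  have h1 := hp.const_mul ((4 * π) ^ (-(d:ℝ) / 2))
  have e : hk f t = fun y => (4 * π) ^ (-(d:ℝ) / 2) * ∫ z, ker d t (y - z) * f z :=
    funext fun y => hk_eq f ht y
  rw [← e] at h1
  have h2 := (ker_time ht hf hB y).const_mul ((4 * π) ^ (-(d:ℝ) / 2))
  refine ⟨_, _, h2.congr_of_eventuallyEq ?_, h1⟩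
  filter_upwards [lt_mem_nhds ht] with s hs using hk_eq f hs y

lemma Jet.grad_eq_zero {d : ℕ} {φ : EE d → ℝ} {x p : EE d} {L : ℝ}
    (h1 : Jet φ x p L) (hm : ∀ y, φ y ≤ φ x) : p = 0 := by
  obtain ⟨D, l, a, b, c, e⟩ := h1
  ext i
  rw [← c i]
  have hmax : IsLocalMax (fun r : ℝ => φ (x + r • ee i)) 0 := by
    refine Filter.Eventually.of_forall fun r => ?_
    simpa using hm _
  exact hmax.hasDerivAt_eq_zero (a i 0)

lemma Eg_lower {d : ℕ} {b τ : ℝ} (hb : 0 < b) (hτ : 0 ≤ τ) (v : EE d) :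
    b * ‖v‖ ^ 2 ≤ Eg b τ v := by
  unfold Eg
  have h := Real.add_one_le_exp ((b + 16 * b ^ 2 * τ) * ‖v‖ ^ 2 + 5 * d * b * τ)
  have h1 : 0 ≤ 16 * b ^ 2 * τ * ‖v‖ ^ 2 := by positivity
  have h2 : 0 ≤ 5 * d * b * τ := by positivity
  nlinarith

lemma comp1 {d : ℕ} (hd : 1 ≤ d) {H : ℝ → EE d → ℝ} {T B : ℝ} (hT : 0 < T)
    (hc : ContinuousOn (fun q : ℝ × EE d => H q.1 q.2) (Set.Icc 0 T ×ˢ Set.univ))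
    (hB : ∀ t ∈ Set.Icc 0 T, ∀ x, |H t x| ≤ B)
    (hs : ∀ t ∈ Set.Ioc 0 T, ∀ x, ∃ Ht p L, HasDerivAt (fun s => H s x) Ht t ∧
      Jet (H t) x p L ∧ Ht ≤ L + ‖p‖ ^ 2)
    {f : EE d → ℝ} (hf : Continuous f) (hf0 : ∀ z, 0 ≤ f z) {B' : ℝ} (hfB : ∀ z, |f z| ≤ B')
    (hi : ∀ z, Real.exp (H 0 z) ≤ f z) :
    ∀ t ∈ Set.Icc 0 T, ∀ y, Real.exp (H t y) ≤ hk f t y := by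
  set b := 1 / (16 * T) with hb'
  have hb : 0 < b := by positivity
  have hbT : 16 * b * T = 1 := by rw [hb']; field_simp
  have hk0 : ∀ t y, 0 ≤ hk f t y := by
    intro t y
    unfold hk
    refine mul_nonneg (by positivity) (integral_nonneg fun z => ?_)
    exact mul_nonneg (Real.exp_pos _).le (hf0 _)
  have key : ∀ δ > (0:ℝ), ∀ t ∈ Set.Icc 0 T, ∀ y,
      Real.exp (H t y) + (-1) * hk f t y + (-δ) * Eg b t (y - 0) ≤ 0 := by
    intro δ hδ
    set R := √(Real.exp B / (b * δ)) with hR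
    refine absmax (m := fun t y => Real.exp (H t y) + (-1) * hk f t y + (-δ) * Eg b t (y - 0))
      ?_ (isCompact_closedBall (0 : EE d) R) ?_ ?_ ?_
    · have h1 := (hk_continuous hf hfB).continuousOn (s := Set.Icc 0 T ×ˢ Set.univ)
      have h2 := ((Eg_continuous b).comp (g := fun q : ℝ × EE d => Eg b q.1 q.2)
        (f := fun q : ℝ × EE d => (q.1, q.2 - 0)) (by fun_prop)).continuousOn (s := Set.Icc 0 T ×ˢ Set.univ)
      exact ((Real.continuous_exp.comp_continuousOn hc).add (continuousOn_const.mul h1)).add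
        (continuousOn_const.mul h2)
    · intro t ht x hx
      rw [Metric.mem_closedBall, dist_zero_right, not_le] at hx
      have h1 : Real.exp (H t x) ≤ Real.exp B := Real.exp_le_exp.2 ((le_abs_self _).trans (hB t ht x))
      have h2 := Eg_lower hb ht.1 (x - 0)
      rw [sub_zero] at h2 ⊢
      have h3 : Real.exp B / (b * δ) ≤ ‖x‖ ^ 2 := by
        rw [← Real.sq_sqrt (by positivity : 0 ≤ Real.exp B / (b * δ)), ← hR]
        have : 0 ≤ R := Real.sqrt_nonneg _
        nlinarith
      rw [div_le_iff₀ (by positivity)] at h3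
      have h4 := hk0 t x
      nlinarith
    · intro x
      have := hi x
      have h2 := Eg_pos b 0 (x - 0)
      simp only [hk_zero]
      nlinarith
    · intro t ht x hm
      obtain ⟨Ht, p, L, a1, a2, a3⟩ := hs t ht x
      obtain ⟨p2, L2, c1, c2⟩ := hk_sol ht.1 hf hfB x
      obtain ⟨e', p3, L3, g1, g2, g3⟩ := Eg_jet hd hb ht.1.le (τ := t) (by nlinarith [ht.2]) x 0
      have hj := ((a2.exp).add (c2.const_mul (-1))).add (g2.const_mul (-δ))
      have ht' := ((a1.exp).add (c1.const_mul (-1))).add (g1.const_mul (-δ))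
      have r1 := hj.nonpos_of_max (fun y => hm t ⟨ht.1.le, ht.2⟩ y)
      have r2 := deriv_nonneg_of_max ht.1 ht' (fun s hs' => hm s ⟨hs'.1, hs'.2.trans ht.2⟩ x)
      have r3 := mul_le_mul_of_nonneg_left a3 (Real.exp_pos (H t x)).le
      nlinarith
  intro t ht y
  refine le_of_forall_pos_le_add fun ε hε => ?_
  have := key (ε / Eg b t (y - 0)) (div_pos hε (Eg_pos _ _ _)) t ht y
  have e := div_mul_cancel₀ ε (Eg_pos b t (y - 0)).ne'
  linarith

lemma grad_lip {d : ℕ} {φ : EE d → ℝ} (hφ : ContDiff ℝ 2 φ) {B : ℝ} (hB : ∀ x, ‖gradient φ x‖ ≤ B)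
    (x ξ : EE d) : φ (x + ξ) - φ x ≤ B * ‖ξ‖ := by
  have h := Convex.norm_image_sub_le_of_norm_fderiv_le (𝕜 := ℝ) (f := φ) (s := Set.univ) (C := B)
    (fun y _ => (hφ.differentiable (by norm_num)) y) (fun y _ => by
      have := hB y
      rwa [gradient, LinearIsometryEquiv.norm_map] at this) convex_univ (Set.mem_univ x)
      (Set.mem_univ (x + ξ))
  simp only [add_sub_cancel_left] at h
  exact (le_abs_self _).trans h

set_option maxHeartbeats 2000000 in
lemma comp2 {d : ℕ} (hd : 1 ≤ d) {V : EE d → ℝ} {W : ℝ → ℝ} {C₀ : ℝ} (hC₀ : 0 < C₀)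
    (hV : IsDepositionRate d V W)
    (hW : ∀ y : ℝ, 0 ≤ y → C₀ * y ^ 2 ≤ y * deriv W y - W y)
    {lam t0 t1 B B' K b c : ℝ} (hlam : 0 < lam) (ht01 : t0 < t1) (h : ℝ → EE d → ℝ)
    (hc : ContinuousOn (fun q : ℝ × EE d => h q.1 q.2) (Set.Icc t0 t1 ×ˢ Set.univ))
    (hC2 : ∀ t ∈ Set.Icc t0 t1, ContDiff ℝ 2 (h t))
    (hB : ∀ t ∈ Set.Icc t0 t1, ∀ x, |h t x| ≤ B)
    (hB' : ∀ t ∈ Set.Icc t0 t1, ∀ x, ‖gradient (h t) x‖ ≤ B')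
    (hpde : ∀ t ∈ Set.Icc t0 t1, ∀ x, HasDerivAt (fun s => h s x)
      (lapl (h t) x + lam * V (gradient (h t) x)) t)
    (x0 : EE d) (hK : 0 ≤ K) (hb : 0 < b) (hbt : 16 * b * (t1 - t0) ≤ 1)
    (hi : ∀ y, Real.exp (2 * lam * h t0 y) ≤ 1 + K * Real.exp (b * ‖y - x0‖ ^ 2))
    (hcdef : c = lam * C₀ / 2) {δ η a : ℝ} (hδ : 0 < δ) (hη : 0 < η) (ha : 1 ≤ a) (ξ : EE d) :
    Real.exp (2 * lam * ((1 - a) * h t1 x0 + a * h t1 (x0 + ξ)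
      + (- (a ^ 2 / (4 * c * (t1 - t0 + η)) * ‖ξ‖ ^ 2) - c * η * B' ^ 2))) ≤
      1 + (K + δ) * Eg b (t1 - t0) (x0 - x0) := by
  have hcp : 0 < c := by rw [hcdef]; positivity
  set M := (a - 1) * B + a * B with hM
  have hB0 : 0 ≤ B := (abs_nonneg _).trans (hB t0 ⟨le_rfl, ht01.le⟩ x0)
  have hM0 : 0 ≤ M := by
    have := sub_nonneg.2 ha
    positivity
  set κ := a ^ 2 / (4 * c * (t1 - t0 + η)) with hκ
  have hκ0 : 0 < κ := by
    have : 0 < t1 - t0 + η := by linarith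
    positivity
  have hKδ : 0 < K + δ := by linarith
  set Φ : ℝ → EE d → EE d → ℝ := fun s x ξ => (1 - a) * h s x + a * h s (x + ξ)
      + (- (a ^ 2 / (4 * c * (s - t0 + η)) * ‖ξ‖ ^ 2) - c * η * B' ^ 2) with hΦ
  suffices hmain : ∀ t ∈ Set.Icc t0 t1, ∀ q : EE d × EE d,
      Real.exp (2 * lam * Φ t q.1 q.2) + (-1) + (-(K + δ)) * Eg b (t - t0) (q.1 - x0) ≤ 0 by
    have := hmain t1 ⟨ht01.le, le_rfl⟩ (x0, ξ)
    simp only [hΦ] at this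
    linarith
  refine absmax (m := fun t (q : EE d × EE d) =>
    Real.exp (2 * lam * Φ t q.1 q.2) + (-1) + (-(K + δ)) * Eg b (t - t0) (q.1 - x0)) ?_
    ((isCompact_closedBall x0 √(Real.exp (2 * lam * M) / (b * (K + δ)))).prod
      (isCompact_closedBall (0 : EE d) √(M / κ))) ?_ ?_ ?_
  · have h1 : ContinuousOn (fun q : ℝ × (EE d × EE d) => h q.1 q.2.1) (Set.Icc t0 t1 ×ˢ Set.univ) :=
      hc.comp (f := fun q : ℝ × (EE d × EE d) => (q.1, q.2.1)) (by fun_prop)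
        (fun q hq => ⟨hq.1, Set.mem_univ _⟩)
    have h2 : ContinuousOn (fun q : ℝ × (EE d × EE d) => h q.1 (q.2.1 + q.2.2)) (Set.Icc t0 t1 ×ˢ Set.univ) :=
      hc.comp (f := fun q : ℝ × (EE d × EE d) => (q.1, q.2.1 + q.2.2)) (by fun_prop)
        (fun q hq => ⟨hq.1, Set.mem_univ _⟩)
    have h3 : ContinuousOn (fun q : ℝ × (EE d × EE d) =>
        - (a ^ 2 / (4 * c * (q.1 - t0 + η)) * ‖q.2.2‖ ^ 2) - c * η * B' ^ 2) (Set.Icc t0 t1 ×ˢ Set.univ) := by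
      refine ContinuousOn.sub (ContinuousOn.neg (ContinuousOn.mul (ContinuousOn.div (by fun_prop) (by fun_prop) ?_)
        (by fun_prop))) (by fun_prop)
      intro q hq
      have : 0 < q.1 - t0 + η := by linarith [hq.1.1]
      positivity
    have h4 := ((Eg_continuous (d := d) b).comp (g := fun q : ℝ × EE d => Eg b q.1 q.2)
        (f := fun q : ℝ × (EE d × EE d) => (q.1 - t0, q.2.1 - x0)) (by fun_prop)).continuousOn (s := Set.Icc t0 t1 ×ˢ Set.univ)
    have h5 := (((continuousOn_const (c := 1 - a)).mul h1).add ((continuousOn_const (c := a)).mul h2)).add h3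
    exact ((Real.continuous_exp.comp_continuousOn ((continuousOn_const (c := 2 * lam)).mul h5)).add
      continuousOn_const).add (continuousOn_const.mul h4)
  · rintro t ht ⟨x, z⟩ hx
    simp only
    have ht0 : 0 < t - t0 + η := by linarith [ht.1]
    have hΦM : Φ t x z ≤ M - κ * ‖z‖ ^ 2 := by
      have h1 := abs_le.1 (hB t ht x)
      have h2 := abs_le.1 (hB t ht (x + z))
      have h3 : κ ≤ a ^ 2 / (4 * c * (t - t0 + η)) := by
        rw [hκ]
        apply div_le_div_of_nonneg_left (by positivity) (by positivity)
        gcongr; exact ht.2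
      have h4 := mul_le_mul_of_nonneg_right h3 (sq_nonneg ‖z‖)
      have h5 : 0 ≤ c * η * B' ^ 2 := by positivity
      simp only [hΦ, hM]
      nlinarith
    have hE := Eg_pos b (t - t0) (x - x0)
    by_cases hz : ‖z‖ ≤ √(M / κ)
    · have hx' : √(Real.exp (2 * lam * M) / (b * (K + δ))) < ‖x - x0‖ := by
        by_contra hcon
        push Not at hcon
        exact hx ⟨by simpa [dist_eq_norm] using hcon, by simpa using hz⟩
      have h3 : Real.exp (2 * lam * M) / (b * (K + δ)) ≤ ‖x - x0‖ ^ 2 := by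
        rw [← Real.sq_sqrt (by positivity : 0 ≤ Real.exp (2 * lam * M) / (b * (K + δ)))]
        gcongr
      rw [div_le_iff₀ (by positivity)] at h3
      have h2 := Eg_lower hb (sub_nonneg.2 ht.1) (x - x0)
      have h4 : Real.exp (2 * lam * Φ t x z) ≤ Real.exp (2 * lam * M) := by
        apply Real.exp_le_exp.2
        gcongr
        have : 0 ≤ κ * ‖z‖ ^ 2 := by positivity
        linarith
      nlinarith
    · push Not at hz
      have h3 : M / κ ≤ ‖z‖ ^ 2 := by
        rw [← Real.sq_sqrt (by positivity : 0 ≤ M / κ)]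
        gcongr
      rw [div_le_iff₀ hκ0] at h3
      have h4 : Real.exp (2 * lam * Φ t x z) ≤ 1 := by
        rw [Real.exp_le_one_iff]
        have : Φ t x z ≤ 0 := by linarith
        nlinarith
      nlinarith
  · rintro ⟨x, z⟩
    simp only
    have ht0 : t0 ∈ Set.Icc t0 t1 := ⟨le_rfl, ht01.le⟩
    have h1 := grad_lip (hC2 t0 ht0) (hB' t0 ht0) x z
    have h2 : Φ t0 x z ≤ h t0 x := by
      simp only [hΦ, sub_self, zero_add]
      have e1 : a ^ 2 / (4 * c * η) * ‖z‖ ^ 2 + c * η * B' ^ 2 - a * (B' * ‖z‖) =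
          c * η * (a * ‖z‖ / (2 * (c * η)) - B') ^ 2 := by
        field_simp; ring
      have e2 : 0 ≤ c * η * (a * ‖z‖ / (2 * (c * η)) - B') ^ 2 := by positivity
      nlinarith
    have h3 : Real.exp (2 * lam * Φ t0 x z) ≤ Real.exp (2 * lam * h t0 x) := by
      apply Real.exp_le_exp.2; gcongr
    have h4 := hi x
    have h5 : Eg b (t0 - t0) (x - x0) = Real.exp (b * ‖x - x0‖ ^ 2) := by simp [Eg]
    rw [h5]
    have := Real.exp_pos (b * ‖x - x0‖ ^ 2)
    nlinarith
  · rintro t ht ⟨x, z⟩ hm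
    have htI : t ∈ Set.Icc t0 t1 := ⟨ht.1.le, ht.2⟩
    simp only [Prod.forall] at hm
    have hS : 0 < t - t0 + η := by linarith [ht.1]
    set S := t - t0 + η with hSdef
    set p := gradient (h t) x with hp
    set p' := gradient (h t) (x + z) with hp'
    -- derivative in the shift
    have hshift : a • p' + (-(a ^ 2 / (4 * c * S))) • ((2:ℝ) • (z - 0)) = 0 := by
      have j1 : Jet (fun y => h t (y + x)) z p' (lapl (h t) (x + z)) := by
        have := Jet.of_contDiff (hC2 t htI) (x + z)
        rw [add_comm x z] at this
        have := this.translate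
        rwa [add_comm z x] at this
      have j2 := (j1.const_mul a).add ((Jet.normsq z (0 : EE d)).const_mul (-(a ^ 2 / (4 * c * S))))
      refine j2.grad_eq_zero fun y => ?_
      have h1 := hm t htI x y
      have h2 : Real.exp (2 * lam * Φ t x y) ≤ Real.exp (2 * lam * Φ t x z) := by linarith
      rw [Real.exp_le_exp] at h2
      have h3 : Φ t x y ≤ Φ t x z := le_of_mul_le_mul_left h2 (by positivity)
      simp only [hΦ] at h3
      rw [add_comm y x, add_comm z x, sub_zero, sub_zero]
      linarith
    have hterm : a ^ 2 / (4 * c * S ^ 2) * ‖z‖ ^ 2 = c * ‖p'‖ ^ 2 := by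
      have e1 : p' = (a / (2 * c * S)) • z := by
        have h1 : a • p' = (a ^ 2 / (4 * c * S) * 2) • z := by
          rw [sub_zero, neg_smul, smul_smul, ← sub_eq_add_neg, sub_eq_zero] at hshift
          exact hshift
        have ha0 : a ≠ 0 := by linarith
        have h2 := congrArg (fun v => a⁻¹ • v) h1
        simp only [smul_smul, inv_mul_cancel₀ ha0, one_smul] at h2
        rw [h2]; congr 1; field_simp; norm_num
      rw [e1, norm_smul, mul_pow, Real.norm_eq_abs, sq_abs]
      field_simp; ring
    -- time derivative
    have hT : HasDerivAt (fun s => Φ s x z)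
        ((1 - a) * (lapl (h t) x + lam * V p) + a * (lapl (h t) (x + z) + lam * V p')
          + a ^ 2 / (4 * c * S ^ 2) * ‖z‖ ^ 2) t := by
      have e1 := ((hpde t htI x).const_mul (1 - a)).add ((hpde t htI (x + z)).const_mul a)
      have e2 : HasDerivAt (fun s => 4 * c * (s - t0 + η)) (4 * c * 1) t :=
        (((hasDerivAt_id t).sub_const t0).add_const η).const_mul (4 * c)
      have e3 := ((((hasDerivAt_const t (a ^ 2)).fun_div e2 (by positivity)).mul_const (‖z‖ ^ 2)).neg).sub_const
        (c * η * B' ^ 2)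
      refine (e1.add e3).congr_deriv ?_
      rw [← hSdef]
      field_simp; ring
    have hJ := ((((Jet.of_contDiff (hC2 t htI) x).const_mul (1 - a)).add
      (((Jet.of_contDiff (hC2 t htI) (x + z)).translate).const_mul a)).add
      (Jet.const (- (a ^ 2 / (4 * c * (t - t0 + η)) * ‖z‖ ^ 2) - c * η * B' ^ 2) x)).const_mul (2 * lam)
    obtain ⟨e', p3, L3, g1, g2, g3⟩ := Eg_jet hd hb (sub_nonneg.2 htI.1) (τ := t - t0)
      (by nlinarith [ht.2]) x x0
    have hJ2 := ((hJ.exp).add (Jet.const (-1) x)).add (g2.const_mul (-(K + δ)))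
    have g1' : HasDerivAt (fun s => Eg b (s - t0) (x - x0)) e' t := by
      have := HasDerivAt.comp t g1 ((hasDerivAt_id t).sub_const t0)
      rw [mul_one] at this
      exact this
    have hT2 := (((hT.const_mul (2 * lam)).exp).add_const (-1)).add (g1'.const_mul (-(K + δ)))
    have r1 := hJ2.nonpos_of_max (fun y => hm t htI y z)
    have r2 := deriv_nonneg_of_max ht.1 hT2 (fun s hs' => hm s ⟨hs'.1, hs'.2.trans ht.2⟩ x z)
    have hkey := V_key hV hW a ha p p'
    rw [hterm] at r2
    simp only [← hp, ← hp', add_zero] at r1 r2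
    rw [norm_smul, mul_pow, Real.norm_eq_abs, sq_abs] at r1
    set q := ‖(1 - a) • p + a • p'‖ ^ 2 with hq
    have hEE : Real.exp (2 * lam * ((1 - a) * h t x + a * h t (x + z) +
        (-(a ^ 2 / (4 * c * (t - t0 + η)) * ‖z‖ ^ 2) - c * η * B' ^ 2))) = Real.exp (2 * lam * Φ t x z) := rfl
    rw [hEE] at r1
    set X := Real.exp (2 * lam * Φ t x z) with hX
    have hX0 : 0 < X := Real.exp_pos _
    set l1 := lapl (h t) x
    set l2 := lapl (h t) (x + z)
    have r3 : 2 * lam * ((1 - a) * (l1 + lam * V p) + a * (l2 + lam * V p') + c * ‖p'‖ ^ 2) ≤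
        2 * lam * ((1 - a) * l1 + a * l2) + (2 * lam) ^ 2 * q := by
      rw [hcdef]
      have := mul_le_mul_of_nonneg_left hkey (by positivity : 0 ≤ 2 * lam * lam)
      linarith
    have r4 := mul_le_mul_of_nonneg_left r3 hX0.le
    have r5 := mul_lt_mul_of_pos_left g3 hKδ
    linarith

lemma ker_mul_integrable {d : ℕ} {f : EE d → ℝ} {B s : ℝ} (hs : 0 < s) (hf : Continuous f)
    (hB : ∀ z, |f z| ≤ B) (y : EE d) : Integrable (fun z => ker d s (y - z) * f z) := by
  have h1 : Integrable (fun z => ker d s (y - z)) := by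
    have := (gauss_integrable' (d := d) (a := 1 / (4 * s)) (by positivity) y).const_mul
      (Real.exp (-((d:ℝ) / 2) * Real.log s))
    refine this.congr (Filter.Eventually.of_forall fun z => ?_)
    simp only [ker]
    rw [← Real.exp_add]; congr 1; ring
  exact h1.mul_bdd hf.aestronglyMeasurable (Filter.Eventually.of_forall hB)

lemma hk_const {d : ℕ} (k t : ℝ) (y : EE d) : hk (fun _ => k) t y = k :=
  hk_zero (fun _ => k) y

lemma hk_sub_one {d : ℕ} {f : EE d → ℝ} {B s : ℝ} (hs : 0 < s) (hf : Continuous f)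
    (hB : ∀ z, |f z| ≤ B) (y : EE d) : hk (fun z => f z - 1) s y = hk f s y - 1 := by
  have h1 := hk_const (d := d) 1 s y
  conv_rhs => rw [← h1]
  rw [hk_eq _ hs, hk_eq _ hs, hk_eq _ hs, ← mul_sub,
    ← integral_sub (ker_mul_integrable hs hf hB y)
      (ker_mul_integrable hs continuous_const (B := 1) (by simp) y)]
  congr 2; funext z; ring

lemma hk_nonneg {d : ℕ} {f : EE d → ℝ} (hf0 : ∀ z, 0 ≤ f z) (t : ℝ) (y : EE d) : 0 ≤ hk f t y := by
  unfold hk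
  refine mul_nonneg (by positivity) (integral_nonneg fun z => ?_)
  exact mul_nonneg (Real.exp_pos _).le (hf0 _)

lemma hk_shift {d : ℕ} {f : EE d → ℝ} {B s : ℝ} (hs : 0 < s) (hf : Continuous f)
    (hB : ∀ z, |f z| ≤ B) (hf0 : ∀ z, 0 ≤ f z) (x y : EE d) :
    hk f s y ≤ Real.exp ((d:ℝ) / 2 * Real.log 9) * Real.exp (‖y - x‖ ^ 2 / (32 * s)) * hk f (9 * s) x := by
  rw [hk_eq _ hs, hk_eq _ (by positivity : 0 < 9 * s)]
  have : ∫ z, ker d s (y - z) * f z ≤ ∫ z, (Real.exp ((d:ℝ) / 2 * Real.log 9) *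
      Real.exp (‖y - x‖ ^ 2 / (32 * s))) * (ker d (9 * s) (x - z) * f z) := by
    refine integral_mono (ker_mul_integrable hs hf hB y)
      ((ker_mul_integrable (by positivity) hf hB x).const_mul _) fun z => ?_
    simp only
    rw [← mul_assoc]
    refine mul_le_mul_of_nonneg_right ?_ (hf0 z)
    rw [ker, ker, ← Real.exp_add, ← Real.exp_add]
    apply Real.exp_le_exp.2
    rw [Real.log_mul (by norm_num) hs.ne']
    have h1 : ‖x - z‖ ≤ ‖y - x‖ + ‖y - z‖ := by
      have : x - z = -(y - x) + (y - z) := by abel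
      rw [this]; exact (norm_add_le _ _).trans (by rw [norm_neg])
    have h2 : ‖x - z‖ ^ 2 / 9 ≤ ‖y - x‖ ^ 2 / 8 + ‖y - z‖ ^ 2 := by
      have := norm_nonneg (x - z)
      nlinarith [sq_nonneg (‖y - x‖ - 8 * ‖y - z‖)]
    have h3 := div_le_div_of_nonneg_right h2 (by positivity : 0 ≤ 4 * s)
    have e1 : ‖x - z‖ ^ 2 / 9 / (4 * s) = ‖x - z‖ ^ 2 / (4 * (9 * s)) := by field_simp
    have e2 : (‖y - x‖ ^ 2 / 8 + ‖y - z‖ ^ 2) / (4 * s) = ‖y - x‖ ^ 2 / (32 * s) + ‖y - z‖ ^ 2 / (4 * s) := by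
      field_simp; ring
    rw [e1, e2] at h3
    linarith
  rw [integral_const_mul] at this
  have h4 := mul_le_mul_of_nonneg_left this (by positivity : 0 ≤ (4 * π) ^ (-(d:ℝ) / 2))
  refine h4.trans (le_of_eq (by ring))

lemma hk_le_fstar {d : ℕ} {f : EE d → ℝ} {B s : ℝ} (hs : 0 < s) (hf : Continuous f)
    (hB : ∀ z, |f z| ≤ B) (hf0 : ∀ z, 0 ≤ f z) (x : EE d) (hfin : fstar f x < ⊤) :
    hk f s x ≤ (fstar f x).toReal := by
  rw [← ENNReal.ofReal_le_iff_le_toReal hfin.ne, hk_eq _ hs, ← integral_const_mul]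
  have hc : 0 ≤ (4 * π) ^ (-(d:ℝ) / 2) := by positivity
  rw [ofReal_integral_eq_lintegral_ofReal ((ker_mul_integrable hs hf hB x).const_mul _)
    (Filter.Eventually.of_forall fun z => mul_nonneg hc (mul_nonneg (ker_pos _ _).le (hf0 z)))]
  unfold fstar
  refine le_trans (le_of_eq ?_) (le_iSup₂ (f := fun τ (_ : τ ∈ Set.Ioi (0:ℝ)) => ∫⁻ y, ENNReal.ofReal
    ((2 * π * τ) ^ (-(d:ℝ)/2) * Real.exp (-‖x - y‖^2 / (2 * τ)) * |f y|)) (2 * s)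
    (by simpa using hs))
  congr 1; funext z
  rw [abs_of_nonneg (hf0 z), show 2 * π * (2 * s) = (4 * π) * s by ring,
    Real.mul_rpow (by positivity) hs.le, Real.rpow_def_of_pos hs, ker]
  congr 1
  rw [mul_assoc, mul_assoc, ← mul_assoc (Real.exp _), ← Real.exp_add]
  congr 3
  field_simp; ring

lemma fstar_mono {d : ℕ} {f g : EE d → ℝ} (hfg : ∀ z, |f z| ≤ |g z|) (x : EE d) :
    fstar f x ≤ fstar g x := by
  unfold fstar
  refine iSup₂_mono fun τ hτ => lintegral_mono fun z => ENNReal.ofReal_le_ofReal ?_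
  have : (0:ℝ) < τ := hτ
  exact mul_le_mul_of_nonneg_left (hfg z) (by positivity)

lemma limit_lemma {d : ℕ} {φ : EE d → ℝ} (hφ : ContDiff ℝ 2 φ) {lam c S B' Q k : ℝ} (hc : 0 < c)
    (hS : 0 < S) (x : EE d)
    (hyp : ∀ δ > 0, ∀ a ≥ 1, ∀ ξ, Real.exp (2 * lam * ((1 - a) * φ x + a * φ (x + ξ)
      + (- (a ^ 2 / (4 * c * (S + δ)) * ‖ξ‖ ^ 2) - c * δ * B' ^ 2))) ≤ 1 + (Q + δ) * k) :
    Real.exp (2 * lam * (φ x + c * S * ‖gradient φ x‖ ^ 2)) ≤ 1 + Q * k := by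
  have h1 : ∀ a ≥ 1, ∀ ξ, Real.exp (2 * lam * ((1 - a) * φ x + a * φ (x + ξ)
      - a ^ 2 / (4 * c * S) * ‖ξ‖ ^ 2)) ≤ 1 + Q * k := by
    intro a ha ξ
    have t1 : Filter.Tendsto (fun δ : ℝ => Real.exp (2 * lam * ((1 - a) * φ x + a * φ (x + ξ)
      + (- (a ^ 2 / (4 * c * (S + δ)) * ‖ξ‖ ^ 2) - c * δ * B' ^ 2)))) (nhdsWithin 0 (Set.Ioi 0))
      (nhds (Real.exp (2 * lam * ((1 - a) * φ x + a * φ (x + ξ)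
      - a ^ 2 / (4 * c * S) * ‖ξ‖ ^ 2)))) := by
      have : ContinuousAt (fun δ : ℝ => Real.exp (2 * lam * ((1 - a) * φ x + a * φ (x + ξ)
        + (- (a ^ 2 / (4 * c * (S + δ)) * ‖ξ‖ ^ 2) - c * δ * B' ^ 2)))) 0 := by
        have : ContinuousAt (fun δ : ℝ => a ^ 2 / (4 * c * (S + δ))) 0 :=
          ContinuousAt.div (by fun_prop) (by fun_prop) (by simp; exact ⟨hc.ne', hS.ne'⟩)
        fun_prop
      have h := this.tendsto.mono_left (nhdsWithin_le_nhds (s := Set.Ioi 0))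
      simpa [sub_eq_add_neg] using h
    have t2 : Filter.Tendsto (fun δ : ℝ => 1 + (Q + δ) * k) (nhdsWithin 0 (Set.Ioi 0))
        (nhds (1 + Q * k)) := by
      have : ContinuousAt (fun δ : ℝ => 1 + (Q + δ) * k) 0 := by fun_prop
      simpa using this.tendsto.mono_left (nhdsWithin_le_nhds (s := Set.Ioi 0))
    refine le_of_tendsto_of_tendsto t1 t2 ?_
    filter_upwards [self_mem_nhdsWithin] with δ hδ using hyp δ hδ a ha ξ
  set g := gradient φ x with hg
  set z := (2 * c * S) • g with hz
  have hd : HasDerivAt (fun r : ℝ => φ (x + r • z)) (2 * c * S * ‖g‖ ^ 2) 0 := by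
    have h2 := ((hφ.differentiable (by norm_num)) (x + (0:ℝ) • z)).hasFDerivAt.comp_hasDerivAt 0
      (hasDerivAt_line x z 0)
    rw [zero_smul, add_zero] at h2
    have h3 : fderiv ℝ φ x z = 2 * c * S * ‖g‖ ^ 2 := by
      have : fderiv ℝ φ x z = inner ℝ g z := by rw [hg]; simp [gradient]
      rw [this, hz, inner_smul_right, real_inner_self_eq_norm_sq]
    rw [← h3]; exact h2
  have hsl : Filter.Tendsto (slope (fun r : ℝ => φ (x + r • z)) 0) (nhdsWithin 0 (Set.Ioi 0))
      (nhds (2 * c * S * ‖g‖ ^ 2)) := by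
    have := hd.hasDerivWithinAt (s := Set.Ioi 0)
    rwa [hasDerivWithinAt_iff_tendsto_slope' (by simp)] at this
  have t3 : Filter.Tendsto (fun r : ℝ => Real.exp (2 * lam * (φ x + slope (fun r : ℝ => φ (x + r • z)) 0 r
      - ‖z‖ ^ 2 / (4 * c * S)))) (nhdsWithin 0 (Set.Ioi 0))
      (nhds (Real.exp (2 * lam * (φ x + 2 * c * S * ‖g‖ ^ 2 - ‖z‖ ^ 2 / (4 * c * S))))) :=
    (Real.continuous_exp.tendsto _).comp (((hsl.const_add (φ x)).sub_const _).const_mul (2 * lam))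
  have e : φ x + 2 * c * S * ‖g‖ ^ 2 - ‖z‖ ^ 2 / (4 * c * S) = φ x + c * S * ‖g‖ ^ 2 := by
    rw [hz, norm_smul, mul_pow, Real.norm_eq_abs, sq_abs]
    field_simp; ring
  rw [e] at t3
  refine le_of_tendsto t3 ?_
  have hmem : Set.Ioo (0:ℝ) 1 ∈ nhdsWithin 0 (Set.Ioi (0:ℝ)) := Ioo_mem_nhdsGT one_pos
  filter_upwards [hmem] with r hr
  have hr0 := hr.1
  have := h1 (1 / r) (by rw [ge_iff_le, le_div_iff₀ hr0]; linarith [hr.2]) (r • z)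
  refine le_trans (le_of_eq ?_) this
  congr 2
  rw [slope_def_field, norm_smul r z, mul_pow, Real.norm_eq_abs, sq_abs]
  simp only [zero_smul, add_zero, sub_zero]
  field_simp; ring

lemma final_arith {A e5 ε u : ℝ} (hA : 1 ≤ A) (he : 1 ≤ e5) (hε : 0 ≤ ε)
    (h : Real.exp (2 * u) ≤ 1 + (2 * A * ε + A ^ 2 * ε ^ 2) * e5) :
    u ≤ A * e5 * Real.log (1 + ε) := by
  have h1 : 1 + (2 * A * ε + A ^ 2 * ε ^ 2) * e5 ≤ (1 + A * e5 * ε) ^ 2 := by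
    have : A ^ 2 * ε ^ 2 * e5 ≤ A ^ 2 * ε ^ 2 * e5 ^ 2 := by
      apply mul_le_mul_of_nonneg_left _ (by positivity)
      nlinarith
    nlinarith
  have h2 : 1 ≤ A * e5 := one_le_mul_of_one_le_of_one_le hA he
  have h3 : 1 + A * e5 * ε ≤ (1 + ε) ^ (A * e5) :=
    one_add_mul_self_le_rpow_one_add (by linarith) h2
  have h4 : Real.exp u ≤ (1 + ε) ^ (A * e5) := by
    refine le_trans ?_ h3
    have : Real.exp u ^ 2 ≤ (1 + A * e5 * ε) ^ 2 := by
      rw [← Real.exp_nat_mul]; push_cast; exact h.trans h1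
    exact (sq_le_sq₀ (Real.exp_pos _).le (by positivity)).1 this
  have h5 := Real.log_le_log (Real.exp_pos _) h4
  rwa [Real.log_exp, Real.log_rpow (by linarith)] at h5

lemma main_bound {d : ℕ} (hd : 1 ≤ d) {V : EE d → ℝ} {W : ℝ → ℝ} {C₀ : ℝ} (hC₀ : 0 < C₀)
    (hV : IsDepositionRate d V W)
    (hW : ∀ y : ℝ, 0 ≤ y → C₀ * y ^ 2 ≤ y * deriv W y - W y)
    {lam T : ℝ} (hlam : 0 < lam) (h : ℝ → EE d → ℝ)
    (hc : ContinuousOn (fun p : ℝ × EE d => h p.1 p.2) (Set.Icc 0 T ×ˢ Set.univ))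
    (hC2 : ∀ t ∈ Set.Ioc (0:ℝ) T, ContDiff ℝ 2 (h t))
    {B B' : ℝ} (hB : ∀ t ∈ Set.Icc (0:ℝ) T, ∀ x, |h t x| ≤ B)
    (hB' : ∀ t ∈ Set.Icc (0:ℝ) T, ∀ x, ‖gradient (h t) x‖ ≤ B')
    (hpde : ∀ t ∈ Set.Ioc (0:ℝ) T, ∀ x, HasDerivAt (fun s => h s x)
      (lapl (h t) x + lam * V (gradient (h t) x)) t)
    (x : EE d) (hfin : fstar (fun y => Real.exp (lam * |h 0 y|)) x < ⊤)
    {t : ℝ} (ht : t ∈ Set.Ioc (0:ℝ) T) :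
    lam ^ 2 * C₀ * t / 4 * ‖gradient (h t) x‖ ^ 2 ≤
      (Real.exp ((d:ℝ) / 2 * Real.log 9) * Real.exp (5 * d / 16) + 1) *
        Real.log ((fstar (fun y => Real.exp (lam * |h 0 y|)) x).toReal) := by
  have ht0 : 0 < t := ht.1
  have hT : 0 < T := ht.1.trans_le ht.2
  set f : EE d → ℝ := fun y => Real.exp (lam * |h 0 y|) with hfdef
  set M := (fstar f x).toReal with hMdef
  set A := Real.exp ((d:ℝ) / 2 * Real.log 9) with hA
  have hA1 : 1 ≤ A := by
    rw [hA]; apply Real.one_le_exp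
    have := Real.log_nonneg (by norm_num : (1:ℝ) ≤ 9)
    positivity
  have h0c : Continuous (h 0) := by
    have h1 : ContinuousOn (fun y : EE d => h ((0:ℝ), y).1 ((0:ℝ), y).2) Set.univ := by
      refine hc.comp (f := fun y : EE d => ((0:ℝ), y)) (by fun_prop) ?_
      intro y _
      exact ⟨⟨le_rfl, hT.le⟩, trivial⟩
    exact continuousOn_univ.1 h1
  have hf : Continuous f := by rw [hfdef]; fun_prop
  have hf1 : ∀ z, 1 ≤ f z := fun z => Real.one_le_exp (by positivity)
  have hf0 : ∀ z, 0 ≤ f z := fun z => (Real.exp_pos _).le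
  have hfB : ∀ z, |f z| ≤ Real.exp (lam * B) := by
    intro z
    rw [abs_of_nonneg (hf0 z)]
    apply Real.exp_le_exp.2
    exact mul_le_mul_of_nonneg_left (hB 0 ⟨le_rfl, hT.le⟩ z) hlam.le
  have hg : Continuous (fun z => f z - 1) := hf.sub continuous_const
  have hg0 : ∀ z, 0 ≤ f z - 1 := fun z => sub_nonneg.2 (hf1 z)
  have hgB : ∀ z, |f z - 1| ≤ Real.exp (lam * B) := by
    intro z
    rw [abs_of_nonneg (hg0 z)]
    have := (le_abs_self _).trans (hfB z)
    linarith
  have hkM : ∀ s > 0, hk f s x ≤ M := fun s hs => hk_le_fstar hs hf hfB hf0 x hfin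
  have hkg : ∀ s > 0, hk (fun z => f z - 1) s x ≤ M - 1 := by
    intro s hs
    rw [hk_sub_one hs hf hfB]
    linarith [hkM s hs]
  have hM1 : 0 ≤ M - 1 := (hk_nonneg hg0 1 x).trans (hkg 1 one_pos)
  have cp : ∀ t ∈ Set.Icc 0 T, ∀ y, Real.exp (lam * h t y) ≤ hk f t y := by
    refine comp1 hd (H := fun t y => lam * h t y) (B := lam * B) hT
      (continuousOn_const.mul hc) ?_ ?_ hf hf0 hfB ?_
    · intro t ht x
      rw [abs_mul, abs_of_pos hlam]
      exact mul_le_mul_of_nonneg_left (hB t ht x) hlam.le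
    · intro t ht x
      refine ⟨_, _, _, (hpde t ht x).const_mul lam, (Jet.of_contDiff (hC2 t ht) x).const_mul lam, ?_⟩
      rw [norm_smul, mul_pow, Real.norm_eq_abs, sq_abs, mul_add]
      have := hV.quadGrowth _ (norm_nonneg (gradient (h t) x))
      rw [← hV.isotropic] at this
      nlinarith [mul_le_mul_of_nonneg_left this (sq_nonneg lam)]
    · intro z
      apply Real.exp_le_exp.2
      exact mul_le_mul_of_nonneg_left (le_abs_self _) hlam.le
  have cm : ∀ t ∈ Set.Icc 0 T, ∀ y, Real.exp ((-lam) * h t y) ≤ hk f t y := by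
    refine comp1 hd (H := fun t y => (-lam) * h t y) (B := lam * B) hT
      (continuousOn_const.mul hc) ?_ ?_ hf hf0 hfB ?_
    · intro t ht x
      rw [abs_mul, abs_neg, abs_of_pos hlam]
      exact mul_le_mul_of_nonneg_left (hB t ht x) hlam.le
    · intro t ht x
      refine ⟨_, _, _, (hpde t ht x).const_mul (-lam),
        (Jet.of_contDiff (hC2 t ht) x).const_mul (-lam), ?_⟩
      rw [norm_smul, mul_pow, Real.norm_eq_abs, sq_abs, mul_add]
      have := hV.nonneg _ (norm_nonneg (gradient (h t) x))
      rw [← hV.isotropic] at this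
      nlinarith [mul_nonneg (sq_nonneg lam) this,
        mul_nonneg (sq_nonneg lam) (sq_nonneg ‖gradient (h t) x‖)]
    · intro z
      apply Real.exp_le_exp.2
      rw [neg_mul, ← mul_neg]
      exact mul_le_mul_of_nonneg_left (neg_le_abs _) hlam.le
  set b := 1 / (8 * t) with hb
  have hbp : 0 < b := by positivity
  set c := lam * C₀ / 2 with hcd
  have hcp : 0 < c := by positivity
  set K := 2 * A * (M - 1) + A ^ 2 * (M - 1) ^ 2 with hK
  have hK0 : 0 ≤ K := by positivity
  have hsub : Set.Icc (t / 2) t ⊆ Set.Ioc 0 T := fun s hs =>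
    ⟨by linarith [hs.1], hs.2.trans ht.2⟩
  have hsub' : Set.Icc (t / 2) t ⊆ Set.Icc 0 T := fun s hs =>
    ⟨by linarith [hs.1], hs.2.trans ht.2⟩
  have hi : ∀ y, Real.exp (2 * lam * h (t / 2) y) ≤ 1 + K * Real.exp (b * ‖y - x‖ ^ 2) := by
    intro y
    set q := Real.exp (‖y - x‖ ^ 2 / (32 * (t / 2))) with hq
    have hq1 : 1 ≤ q := Real.one_le_exp (by positivity)
    have e1 : Real.exp (b * ‖y - x‖ ^ 2) = q ^ 2 := by
      rw [hq, ← Real.exp_nat_mul, hb]; congr 1; push_cast; field_simp; norm_num; ring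
    have e2 : Real.exp (2 * lam * h (t / 2) y) = Real.exp (lam * h (t / 2) y) ^ 2 := by
      rw [← Real.exp_nat_mul]; congr 1; push_cast; ring
    have h1 := cp (t / 2) (hsub' ⟨le_rfl, by linarith⟩) y
    have h2 := hk_sub_one (by linarith : 0 < t / 2) hf hfB y
    have h3 := hk_shift (by linarith : 0 < t / 2) hg hgB hg0 x y
    have h4 : A * q * hk (fun z => f z - 1) (9 * (t / 2)) x ≤ A * q * (M - 1) :=
      mul_le_mul_of_nonneg_left (hkg _ (by linarith)) (by positivity)
    have h5 : Real.exp (lam * h (t / 2) y) ≤ 1 + A * q * (M - 1) := by linarith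
    rw [e1, e2]
    have h6 : Real.exp (lam * h (t / 2) y) ^ 2 ≤ (1 + A * q * (M - 1)) ^ 2 :=
      pow_le_pow_left₀ (Real.exp_pos _).le h5 2
    have h7 : A * (M - 1) * q ≤ A * (M - 1) * q ^ 2 := by
      apply mul_le_mul_of_nonneg_left _ (by positivity)
      nlinarith
    rw [hK]
    nlinarith
  have hlim := limit_lemma (hC2 t ht) (lam := lam) (B' := B') (Q := K)
    (k := Eg b (t - t / 2) (x - x)) hcp (S := t - t / 2) (by linarith) x
    (fun δ hδ a ha ξ => comp2 hd hC₀ hV hW hlam (by linarith : t / 2 < t) h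
      (hc.mono (Set.prod_mono hsub' le_rfl)) (fun s hs => hC2 s (hsub hs))
      (fun s hs => hB s (hsub' hs)) (fun s hs => hB' s (hsub' hs))
      (fun s hs => hpde s (hsub hs)) x hK0 hbp
      (by rw [hb]; field_simp; norm_num) hi hcd hδ hδ ha ξ)
  have hE : Eg b (t - t / 2) (x - x) = Real.exp (5 * d / 16) := by
    unfold Eg
    rw [sub_self, norm_zero, hb]; congr 1; field_simp; ring
  rw [hE, mul_assoc] at hlim
  have e51 : 1 ≤ Real.exp (5 * (d:ℝ) / 16) := Real.one_le_exp (by positivity)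
  have r1 := final_arith hA1 e51 hM1 hlim
  rw [show 1 + (M - 1) = M by ring] at r1
  have r2 : (-lam) * h t x ≤ Real.log M := by
    rw [Real.le_log_iff_exp_le (by linarith)]
    exact (cm t ⟨ht.1.le, ht.2⟩ x).trans (hkM t ht0)
  have r3 : lam ^ 2 * C₀ * t / 4 * ‖gradient (h t) x‖ ^ 2 =
      lam * (h t x + c * (t - t / 2) * ‖gradient (h t) x‖ ^ 2) + (-lam) * h t x := by
    rw [hcd]; ring
  rw [r3, add_mul, one_mul]
  exact add_le_add r1 r2

/-- Under the strengthened assumption `y W'(y) - W(y) ≥ C₀ y²` there is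
`C > 0` depending only on `d` and `C₀` such that every bounded classical solution of
`∂ₜh = Δh + λV(∇h)` lying in `H^{2λ}([0,T])` satisfies the pointwise gradient bound
`|∇h(t,x)| ≤ C (|||h₀|||_{H^λ}(x)/(λt))^{1/2}` on `(0,T] × ℝ^d`. -/
theorem statement17 {d : ℕ} (hd : 1 ≤ d) (C₀ : ℝ) (hC₀ : 0 < C₀) :
    ∃ C > (0:ℝ),
      ∀ (V : EuclideanSpace ℝ (Fin d) → ℝ) (W : ℝ → ℝ), IsDepositionRate d V W →
      (∀ y : ℝ, 0 ≤ y → C₀ * y ^ 2 ≤ y * deriv W y - W y) →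
      ∀ (lam T : ℝ), 0 < lam → 0 < T →
      ∀ (h₀ : EuclideanSpace ℝ (Fin d) → ℝ) (h : ℝ → EuclideanSpace ℝ (Fin d) → ℝ),
        ContinuousOn (fun p : ℝ × EuclideanSpace ℝ (Fin d) => h p.1 p.2)
          (Set.Icc 0 T ×ˢ Set.univ) →
        (∀ t ∈ Set.Ioc (0:ℝ) T, ContDiff ℝ 2 (h t)) →
        (∀ (x : EuclideanSpace ℝ (Fin d)), ∀ t ∈ Set.Ioc (0:ℝ) T,
          DifferentiableAt ℝ (fun s => h s x) t) →
        (∃ B, ∀ t ∈ Set.Icc (0:ℝ) T, ∀ x, |h t x| ≤ B) →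
        (∃ B, ∀ t ∈ Set.Icc (0:ℝ) T, ∀ x, ‖gradient (h t) x‖ ≤ B) →
        (∀ t ∈ Set.Ioc (0:ℝ) T, ∀ x,
          deriv (fun s => h s x) t = lapl (h t) x + lam * V (gradient (h t) x)) →
        (∀ x, h 0 x = h₀ x) →
        (∀ x, (⨆ t ∈ Set.Icc (0:ℝ) T,
          fstar (fun y => Real.exp (2 * lam * |h t y|)) x) < ⊤) →
        ∀ t ∈ Set.Ioc (0:ℝ) T, ∀ x,
          ‖gradient (h t) x‖ ≤ C * (Hnorm lam h₀ x / (lam * t)) ^ ((1:ℝ)/2) := by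
  set D := Real.exp ((d:ℝ) / 2 * Real.log 9) * Real.exp (5 * d / 16) + 1 with hD
  have hDp : 0 < D := by positivity
  refine ⟨√(4 * D / C₀), by positivity, ?_⟩
  rintro V W hV hW lam T hlam hT h₀ h hc hC2 hdiff ⟨B, hB⟩ ⟨B', hB'⟩ hpde hinit hsup t ht x
  have h0eq : h 0 = h₀ := funext hinit
  subst h0eq
  have hfin : fstar (fun y => Real.exp (lam * |h 0 y|)) x < ⊤ := by
    refine lt_of_le_of_lt ?_ (hsup x)
    refine le_trans (fstar_mono (g := fun y => Real.exp (2 * lam * |h 0 y|)) (fun z => ?_) x)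
      (le_iSup₂ (f := fun t (_ : t ∈ Set.Icc (0:ℝ) T) =>
        fstar (fun y => Real.exp (2 * lam * |h t y|)) x) 0 ⟨le_rfl, hT.le⟩)
    rw [abs_of_pos (Real.exp_pos _), abs_of_pos (Real.exp_pos _)]
    apply Real.exp_le_exp.2
    nlinarith [mul_nonneg hlam.le (abs_nonneg (h 0 z))]
  have key := main_bound hd hC₀ hV hW hlam h hc hC2 hB hB'
    (fun s hs y => by rw [← hpde s hs y]; exact (hdiff y s hs).hasDerivAt) x hfin ht
  have ht0 := ht.1
  rw [← Real.sqrt_eq_rpow, ← Real.sqrt_mul (by positivity)]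
  apply Real.le_sqrt_of_sq_le
  unfold Hnorm
  set N := Real.log ((fstar (fun y => Real.exp (lam * |h 0 y|)) x).toReal)
  have e : 4 * D / C₀ * (1 / lam * N / (lam * t)) = (D * N) / (lam ^ 2 * C₀ * t / 4) := by
    field_simp
  rw [e, le_div_iff₀ (by positivity)]
  linarith
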